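/- For every real n > 0, ∫_0^∞ ( ψ(1+x) - log x ) cos(2πnx) dx = (1/2)( ψ(1+n) - log n ); that is, the function ψ(1+x) - log x is self-reciprocal under the Fourier cosine transform with kernel cos(2πnx). -/

import Mathlib

open Real MeasureTheory Filter intervalIntegral

/-- The digamma function `ψ = Γ'/Γ`. -/
noncomputable def digamma (x : ℝ) : ℝ := deriv Real.Gamma x / Real.Gamma x

section

open Set Topology

lemma hasDerivAt_log_Gamma {x : ℝ} (hx : 0 < x) :
    HasDerivAt (Real.log ∘ Real.Gamma) (digamma x) x := by
  have h : DifferentiableAt ℝ Real.Gamma x :=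
    Real.differentiableAt_Gamma fun m => by
      have : (0 : ℝ) ≤ m := m.cast_nonneg
      linarith
  exact h.hasDerivAt.log (Real.Gamma_pos_of_pos hx).ne'

lemma log_Gamma_add_one {x : ℝ} (hx : 0 < x) :
    Real.log (Real.Gamma (x + 1)) = Real.log x + Real.log (Real.Gamma x) := by
  rw [Real.Gamma_add_one hx.ne', Real.log_mul hx.ne' (Real.Gamma_pos_of_pos hx).ne']

lemma digamma_le_log {x : ℝ} (hx : 0 < x) : digamma x ≤ Real.log x := by
  have h := Real.convexOn_log_Gamma.le_slope_of_hasDerivAt (mem_Ioi.2 hx)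
    (mem_Ioi.2 (by linarith : 0 < x + 1)) (by linarith) (hasDerivAt_log_Gamma hx)
  simpa [slope_def_field, log_Gamma_add_one hx] using h

lemma log_le_digamma_add_one {x : ℝ} (hx : 0 < x) : Real.log x ≤ digamma (x + 1) := by
  have h := Real.convexOn_log_Gamma.slope_le_of_hasDerivAt (mem_Ioi.2 hx)
    (mem_Ioi.2 (by linarith : 0 < x + 1)) (by linarith) (hasDerivAt_log_Gamma (by linarith))
  simpa [slope_def_field, log_Gamma_add_one hx] using h

lemma digamma_add_one {x : ℝ} (hx : 0 < x) : digamma (x + 1) = digamma x + 1 / x := by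
  have h1 : HasDerivAt (fun y => (Real.log ∘ Real.Gamma) (y + 1)) (digamma (x + 1)) x :=
    (hasDerivAt_log_Gamma (by linarith : 0 < x + 1)).comp_add_const x 1
  have h2 : HasDerivAt (fun y => Real.log y + (Real.log ∘ Real.Gamma) y)
      (x⁻¹ + digamma x) x := (Real.hasDerivAt_log hx.ne').add (hasDerivAt_log_Gamma hx)
  have h3 : (fun y => (Real.log ∘ Real.Gamma) (y + 1)) =ᶠ[𝓝 x]
      fun y => Real.log y + (Real.log ∘ Real.Gamma) y := by
    filter_upwards [lt_mem_nhds hx] with y hy using log_Gamma_add_one hy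
  rw [h1.unique (h2.congr_of_eventuallyEq h3)]
  ring

lemma one_div_succ_le_log_div {y : ℝ} (hy : 0 < y) :
    1 / (y + 1) ≤ Real.log ((y + 1) / y) := by
  have h := Real.one_sub_inv_le_log_of_pos (by positivity : 0 < (y + 1) / y)
  refine le_trans (le_of_eq ?_) h
  field_simp
  ring

lemma sum_log_sub_eq_digamma {x : ℝ} (hx : 0 < x) (N : ℕ) :
    ∑ k ∈ Finset.range N, (Real.log ((x + k + 1) / (x + k)) - 1 / (x + k + 1)) =
      digamma (1 + x) - Real.log x - (digamma (x + N + 1) - Real.log (x + N)) := by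
  induction N with
  | zero => simp [add_comm]
  | succ N ih =>
    have hN : (0 : ℝ) ≤ N := N.cast_nonneg
    rw [Finset.sum_range_succ, ih, Real.log_div (by positivity) (by positivity)]
    push_cast
    rw [← add_assoc, digamma_add_one (by positivity : 0 < x + N + 1)]
    ring

lemma hasSum_digamma_sub_log {x : ℝ} (hx : 0 < x) :
    HasSum (fun k : ℕ => Real.log ((x + k + 1) / (x + k)) - 1 / (x + k + 1))
      (digamma (1 + x) - Real.log x) := by
  rw [hasSum_iff_tendsto_nat_of_nonneg
    fun k => sub_nonneg.2 (one_div_succ_le_log_div (by positivity))]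
  simp_rw [sum_log_sub_eq_digamma hx]
  have hlim : Tendsto (fun N : ℕ => 1 / (x + N)) atTop (𝓝 0) :=
    tendsto_const_nhds.div_atTop
      (tendsto_atTop_add_const_left _ x tendsto_natCast_atTop_atTop)
  have h0 : Tendsto (fun N : ℕ => digamma (x + N + 1) - Real.log (x + N)) atTop (𝓝 0) := by
    refine tendsto_of_tendsto_of_tendsto_of_le_of_le tendsto_const_nhds hlim
      (fun N => sub_nonneg.2 (log_le_digamma_add_one (by positivity))) fun N => ?_
    have hp : 0 < x + N := by positivity
    have h1 := digamma_le_log (by positivity : 0 < x + N + 1)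
    have h2 := Real.log_le_sub_one_of_pos (by positivity : 0 < (x + N + 1) / (x + N))
    rw [Real.log_div (by positivity) hp.ne'] at h2
    have h3 : (x + N + 1) / (x + N) - 1 = 1 / (x + N) := by field_simp; ring
    simp only
    linarith
  simpa using tendsto_const_nhds.sub h0

lemma integral_telescoping_kernel {K : ℝ → ℝ → ℝ} {w φ : ℝ → ℝ} {c x : ℝ} (hx : 0 < x)
    (hc : 0 ≤ c) (hK : Measurable (Function.uncurry K)) (hw : Measurable w) (hφ : Measurable φ)
    (hw0 : ∀ t, 0 < t → 0 ≤ w t) (hanti : ∀ t, 0 < t → AntitoneOn (K t) (Ici 0))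
    (hKcont : ∀ t, 0 < t → Continuous (K t))
    (hsum : ∀ t, 0 < t →
      HasSum (fun k : ℕ => ∫ u in (0 : ℝ)..1, (K t (k + u) - K t (k + 1))) (φ t))
    (hL : ∀ v, 0 < v → IntegrableOn (fun t => K t v * w t) (Ioi 0) ∧
      ∫ t in Ioi 0, K t v * w t = c / (x + v)) :
    IntegrableOn (fun t => φ t * w t) (Ioi 0) ∧
      ∫ t in Ioi 0, φ t * w t = c * (digamma (1 + x) - Real.log x) := by
  have hD : ∀ k : ℕ, ∀ t, 0 < t → ∀ u ∈ Ioc (0 : ℝ) 1, 0 ≤ K t (k + u) - K t (k + 1) := by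
    intro k t ht u hu
    have hk : (0 : ℝ) ≤ k := k.cast_nonneg
    exact sub_nonneg.2 (hanti t ht (mem_Ici.2 (by linarith [hu.1])) (mem_Ici.2 (by linarith))
      (by linarith [hu.2]))
  have hDI : ∀ k : ℕ, ∀ t, 0 < t → 0 ≤ ∫ u in (0 : ℝ)..1, (K t (k + u) - K t (k + 1)) := by
    intro k t ht
    rw [intervalIntegral.integral_of_le zero_le_one]
    exact setIntegral_nonneg measurableSet_Ioc (hD k t ht)
  have hφ0 : ∀ t, 0 < t → 0 ≤ φ t := fun t ht => (hsum t ht).nonneg fun k => hDI k t ht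
  have hA : ∀ t ∈ Ioi (0 : ℝ), ENNReal.ofReal (φ t * w t) =
      ∑' k : ℕ, ∫⁻ u in Ioc (0 : ℝ) 1, ENNReal.ofReal ((K t (k + u) - K t (k + 1)) * w t) := by
    intro t ht
    have hs := (hsum t ht).mul_right (w t)
    rw [← hs.tsum_eq, ENNReal.ofReal_tsum_of_nonneg
      (fun k => mul_nonneg (hDI k t ht) (hw0 t ht)) hs.summable]
    refine tsum_congr fun k => ?_
    rw [← intervalIntegral.integral_mul_const, intervalIntegral.integral_of_le zero_le_one,
      ofReal_integral_eq_lintegral_ofReal]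
    · have := hKcont t ht
      exact (Continuous.integrableOn_Icc (by fun_prop)).mono_set Ioc_subset_Icc_self
    · filter_upwards [ae_restrict_mem measurableSet_Ioc] with u hu
      exact mul_nonneg (hD k t ht u hu) (hw0 t ht)
  have hmeas : ∀ k : ℕ, Measurable (Function.uncurry fun t u : ℝ =>
      ENNReal.ofReal ((K t (k + u) - K t (k + 1)) * w t)) := by
    intro k
    have h1 : Measurable fun p : ℝ × ℝ => K p.1 (k + p.2) :=
      hK.comp (measurable_fst.prodMk (measurable_snd.const_add _))
    have h2 : Measurable fun p : ℝ × ℝ => K p.1 (k + 1) :=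
      hK.comp (measurable_fst.prodMk measurable_const)
    exact ((h1.sub h2).mul (hw.comp measurable_fst)).ennreal_ofReal
  have hB : ∀ k : ℕ, ∫⁻ t in Ioi (0 : ℝ), ∫⁻ u in Ioc (0 : ℝ) 1,
      ENNReal.ofReal ((K t (k + u) - K t (k + 1)) * w t) =
      ENNReal.ofReal (c * (Real.log ((x + k + 1) / (x + k)) - 1 / (x + k + 1))) := by
    intro k
    have hk : (0 : ℝ) ≤ k := k.cast_nonneg
    rw [lintegral_lintegral_swap (hmeas k).aemeasurable]
    have h1 : ∀ u ∈ Ioc (0 : ℝ) 1, ∫⁻ t in Ioi (0 : ℝ),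
        ENNReal.ofReal ((K t (k + u) - K t (k + 1)) * w t) =
        ENNReal.ofReal (c / (x + (k + u)) - c / (x + (k + 1))) := by
      intro u hu
      obtain ⟨i1, e1⟩ := hL (k + u) (by linarith [hu.1])
      obtain ⟨i2, e2⟩ := hL (k + 1) (by linarith)
      rw [← e1, ← e2, ← integral_sub i1 i2, ofReal_integral_eq_lintegral_ofReal
        (f := fun t => K t (k + u) * w t - K t (k + 1) * w t) (i1.sub i2)]
      · simp_rw [sub_mul]
      · filter_upwards [ae_restrict_mem measurableSet_Ioi] with t ht
        have := mul_nonneg (hD k t ht u hu) (hw0 t ht)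
        simpa [sub_mul] using this
    rw [setLIntegral_congr_fun measurableSet_Ioc h1]
    have hcont : ContinuousOn (fun u : ℝ => c / (x + (k + u)) - c / (x + (k + 1)))
        (Icc 0 1) := by
      refine ContinuousOn.sub (ContinuousOn.div (by fun_prop) (by fun_prop) fun u hu => ?_)
        continuousOn_const
      have := hu.1
      positivity
    rw [← ofReal_integral_eq_lintegral_ofReal
      (hcont.integrableOn_Icc.mono_set Ioc_subset_Icc_self),
      ← intervalIntegral.integral_of_le zero_le_one]
    · congr 1
      rw [integral_eq_sub_of_hasDerivAt
        (f := fun u : ℝ => c * Real.log (x + (k + u)) - c / (x + (k + 1)) * u)]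
      · rw [Real.log_div (by positivity) (by positivity)]
        simp only [add_zero, ← add_assoc]
        ring
      · intro u hu
        rw [uIcc_of_le zero_le_one] at hu
        have hp : x + (k + u) ≠ 0 := by have := hu.1; positivity
        have h2 : HasDerivAt (fun u : ℝ => x + (k + u)) 1 u :=
          ((hasDerivAt_id u).const_add _).const_add _
        refine (((h2.log hp).const_mul c).sub
          ((hasDerivAt_id u).const_mul (c / (x + (k + 1))))).congr_deriv ?_
        ring
      · exact ContinuousOn.intervalIntegrable (by rwa [uIcc_of_le zero_le_one])
    · filter_upwards [ae_restrict_mem measurableSet_Ioc] with u hu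
      have := hu.1
      exact sub_nonneg.2 (div_le_div_of_nonneg_left hc (by positivity) (by linarith [hu.2]))
  have hg := (hasSum_digamma_sub_log hx).mul_left c
  have hg0 : ∀ k : ℕ, 0 ≤ c * (Real.log ((x + k + 1) / (x + k)) - 1 / (x + k + 1)) :=
    fun k => mul_nonneg hc (sub_nonneg.2 (one_div_succ_le_log_div (by positivity)))
  have hC : ∫⁻ t in Ioi (0 : ℝ), ENNReal.ofReal (φ t * w t) =
      ENNReal.ofReal (c * (digamma (1 + x) - Real.log x)) := by
    rw [setLIntegral_congr_fun measurableSet_Ioi hA,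
      lintegral_tsum fun k => (hmeas k).lintegral_prod_right.aemeasurable, ← hg.tsum_eq,
      ENNReal.ofReal_tsum_of_nonneg hg0 hg.summable]
    exact tsum_congr hB
  have hpos : 0 ≤ᵐ[volume.restrict (Ioi (0 : ℝ))] fun t => φ t * w t := by
    filter_upwards [ae_restrict_mem measurableSet_Ioi] with t ht
    exact mul_nonneg (hφ0 t ht) (hw0 t ht)
  have hsm : AEStronglyMeasurable (fun t => φ t * w t) (volume.restrict (Ioi (0 : ℝ))) :=
    (hφ.mul hw).aestronglyMeasurable
  refine ⟨⟨hsm, ?_⟩, ?_⟩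
  · rw [hasFiniteIntegral_iff_ofReal hpos, hC]
    exact ENNReal.ofReal_lt_top
  · rw [integral_eq_lintegral_of_nonneg_ae hpos hsm, hC,
      ENNReal.toReal_ofReal (hg.nonneg hg0)]

/-- The density of `ψ (1 + x) - log x` as a Laplace transform. -/
noncomputable def digammaKernel (t : ℝ) : ℝ := 1 / t - 1 / (Real.exp t - 1)

lemma measurable_digammaKernel : Measurable digammaKernel := by
  unfold digammaKernel
  fun_prop

lemma digammaKernel_nonneg {t : ℝ} (ht : 0 < t) : 0 ≤ digammaKernel t :=
  sub_nonneg.2 (one_div_le_one_div_of_le ht (by linarith [Real.add_one_le_exp t]))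

lemma integral_exp_kernel {t : ℝ} (ht : 0 < t) (k : ℕ) :
    ∫ u in (0 : ℝ)..1, (Real.exp (-((k + u) * t)) - Real.exp (-((k + 1) * t))) =
      Real.exp (-t) ^ k * ((1 - Real.exp (-t)) / t - Real.exp (-t)) := by
  rw [integral_eq_sub_of_hasDerivAt
    (f := fun u : ℝ => -Real.exp (-((k + u) * t)) / t - Real.exp (-((k + 1) * t)) * u)]
  · have h1 : Real.exp (-(((k : ℝ) + 1) * t)) = Real.exp (-t) ^ k * Real.exp (-t) := by
      rw [← Real.exp_nat_mul, ← Real.exp_add]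
      ring_nf
    have h0 : Real.exp (-(((k : ℝ) + 0) * t)) = Real.exp (-t) ^ k := by
      rw [← Real.exp_nat_mul]
      ring_nf
    simp only [h1, h0]
    ring
  · intro u _
    have h : HasDerivAt (fun u : ℝ => -((k + u) * t)) (-(1 * t)) u :=
      (((hasDerivAt_id u).const_add (k : ℝ)).mul_const t).neg
    refine ((h.exp.neg.div_const t).sub
      ((hasDerivAt_id u).const_mul (Real.exp (-((k + 1) * t))))).congr_deriv ?_
    field_simp
  · exact Continuous.intervalIntegrable (by fun_prop) _ _

lemma hasSum_exp_kernel {t : ℝ} (ht : 0 < t) :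
    HasSum (fun k : ℕ => ∫ u in (0 : ℝ)..1,
      (Real.exp (-((k + u) * t)) - Real.exp (-((k + 1) * t)))) (digammaKernel t) := by
  simp_rw [integral_exp_kernel ht]
  have hlt : Real.exp (-t) < 1 := by simpa using ht
  have hs := (hasSum_geometric_of_lt_one (Real.exp_pos (-t)).le hlt).mul_right
    ((1 - Real.exp (-t)) / t - Real.exp (-t))
  suffices h : digammaKernel t =
      (1 - Real.exp (-t))⁻¹ * ((1 - Real.exp (-t)) / t - Real.exp (-t)) from h ▸ hs
  have h1 : Real.exp t - 1 ≠ 0 := by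
    have := Real.add_one_lt_exp ht.ne'
    linarith
  rw [digammaKernel]
  rw [Real.exp_neg] at hlt ⊢
  have h2 := Real.exp_ne_zero t
  have h3 : 1 - (Real.exp t)⁻¹ = (Real.exp t - 1) / Real.exp t := by field_simp
  rw [h3]
  field_simp

lemma integral_exp_mul_exp {x v : ℝ} (hx : 0 < x) (hv : 0 < v) :
    IntegrableOn (fun t => Real.exp (-(v * t)) * Real.exp (-(x * t))) (Ioi 0) ∧
      ∫ t in Ioi 0, Real.exp (-(v * t)) * Real.exp (-(x * t)) = 1 / (x + v) := by
  have h : (fun t => Real.exp (-(v * t)) * Real.exp (-(x * t))) =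
      fun t => Real.exp (-(x + v) * t) := by
    ext t
    rw [← Real.exp_add]
    ring_nf
  have hneg : -(x + v) < 0 := by linarith
  rw [h]
  refine ⟨integrableOn_exp_mul_Ioi hneg 0, ?_⟩
  rw [integral_exp_mul_Ioi hneg 0]
  rw [mul_zero, Real.exp_zero, neg_div_neg_eq]

lemma digamma_sub_log_eq_laplace {x : ℝ} (hx : 0 < x) :
    IntegrableOn (fun t => digammaKernel t * Real.exp (-(x * t))) (Ioi 0) ∧
      ∫ t in Ioi 0, digammaKernel t * Real.exp (-(x * t)) =
        digamma (1 + x) - Real.log x := by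
  have h := integral_telescoping_kernel (K := fun t u => Real.exp (-(u * t)))
    (w := fun t => Real.exp (-(x * t))) hx zero_le_one
    (by unfold Function.uncurry; fun_prop) (by fun_prop) measurable_digammaKernel
    (fun t _ => (Real.exp_pos _).le)
    (fun t ht u _ v _ huv => Real.exp_le_exp.2 (by nlinarith))
    (fun t _ => by fun_prop) (fun t ht => hasSum_exp_kernel ht)
    (fun v hv => integral_exp_mul_exp hx hv)
  simpa using h

lemma hasSum_inv_exp_sub_one {t : ℝ} (ht : 0 < t) :
    HasSum (fun k : ℕ => 2 * t / (t ^ 2 + (2 * π * (k + 1)) ^ 2))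
      (1 / 2 - digammaKernel t) := by
  have hπ : (π : ℂ) ≠ 0 := by exact_mod_cast Real.pi_ne_zero
  have htC : (t : ℂ) ≠ 0 := by exact_mod_cast ht.ne'
  set z : ℂ := Complex.I * t / (2 * π) with hz
  have hz' : z = ((t / (2 * π) : ℝ) : ℂ) * Complex.I := by
    rw [hz]; push_cast; ring
  have him : z.im = t / (2 * π) := by
    rw [hz']; simp [-Complex.ofReal_div]
  have hzmem : z ∈ Complex.integerComplement := by
    rintro ⟨m, hm⟩
    have h0 : z.im = 0 := by rw [← hm]; simp
    rw [him] at h0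
    have : 0 < t / (2 * π) := by positivity
    linarith
  have hs := (summable_cotTerm hzmem).hasSum
  simp only [cotTerm] at hs
  rw [← cot_series_rep' hzmem, Complex.cot_pi_eq_exp_ratio] at hs
  have hexp : Complex.exp (2 * π * Complex.I * z) = ((Real.exp (-t) : ℝ) : ℂ) := by
    rw [Complex.ofReal_exp]
    congr 1
    rw [hz]
    push_cast
    field_simp
    rw [Complex.I_sq]
  rw [hexp] at hs
  have hs2 := hs.mul_left (Complex.I / (2 * π))
  have e1 : ∀ k : ℕ, ((2 * t / (t ^ 2 + (2 * π * (k + 1)) ^ 2) : ℝ) : ℂ) =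
      Complex.I / (2 * π) * (1 / (z - (k + 1)) + 1 / (z + (k + 1))) := by
    intro k
    have hden : (t : ℂ) ^ 2 + (2 * π * (k + 1)) ^ 2 ≠ 0 := by
      have : 0 < t ^ 2 + (2 * π * (k + 1)) ^ 2 := by positivity
      exact_mod_cast this.ne'
    have hne : ∀ m : ℤ, z - m ≠ 0 := fun m h => hzmem ⟨m, (sub_eq_zero.1 h).symm⟩
    have h1 : z - (k + 1) ≠ 0 := by simpa using hne (k + 1)
    have h2 : z + (k + 1) ≠ 0 := by
      have := hne (-(k + 1))
      push_cast at this
      rwa [sub_neg_eq_add] at this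
    have h3 : 1 / (z - (k + 1)) + 1 / (z + (k + 1)) = 2 * z / (z ^ 2 - (k + 1) ^ 2) := by
      have h4 : z ^ 2 - (k + 1) ^ 2 ≠ 0 := by
        rw [sq_sub_sq]; exact mul_ne_zero h2 h1
      rw [sq_sub_sq] at h4 ⊢
      field_simp
      ring
    have h5 : z ^ 2 - (k + 1) ^ 2 =
        -(((t : ℂ) ^ 2 + (2 * π * (k + 1)) ^ 2) / (2 * π) ^ 2) := by
      rw [hz]
      field_simp
      rw [Complex.I_sq]
      ring
    rw [h3, h5, hz]
    push_cast
    field_simp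
    rw [Complex.I_sq]
    ring
  have e2 : ((1 / 2 - digammaKernel t : ℝ) : ℂ) = Complex.I / (2 * π) *
      (π * (((Real.exp (-t) : ℝ) + 1) / (Complex.I * (1 - (Real.exp (-t) : ℝ)))) - 1 / z) := by
    have hq : Real.exp (-t) = (Real.exp t)⁻¹ := Real.exp_neg t
    have h1 : Real.exp t - 1 ≠ 0 := by
      have := Real.add_one_lt_exp ht.ne'
      linarith
    have h1C : (Complex.exp t : ℂ) - 1 ≠ 0 := by exact_mod_cast h1
    have h2C := Complex.exp_ne_zero t
    rw [hq, digammaKernel, hz]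
    push_cast
    have h3 : 1 - (Complex.exp t)⁻¹ = (Complex.exp t - 1) / Complex.exp t := by field_simp
    rw [h3]
    field_simp
    ring
  rw [← Complex.hasSum_ofReal]
  simpa only [e1, e2] using hs2

lemma integral_cauchy_kernel {t : ℝ} (ht : 0 < t) (k : ℕ) :
    ∫ u in (0 : ℝ)..1, (2 * t / (t ^ 2 + (2 * π * (k + u)) ^ 2) -
        2 * t / (t ^ 2 + (2 * π * (k + 1)) ^ 2)) =
      1 / π * Real.arctan (2 * π * (k + 1) / t) - 1 / π * Real.arctan (2 * π * k / t) -
        2 * t / (t ^ 2 + (2 * π * (k + 1)) ^ 2) := by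
  rw [integral_eq_sub_of_hasDerivAt
    (f := fun u : ℝ => 1 / π * Real.arctan (2 * π * (k + u) / t) -
      2 * t / (t ^ 2 + (2 * π * (k + 1)) ^ 2) * u)]
  · simp only [add_zero]
    ring
  · intro u _
    have h : HasDerivAt (fun u : ℝ => 2 * π * (k + u) / t) (2 * π * 1 / t) u :=
      (((hasDerivAt_id u).const_add (k : ℝ)).const_mul (2 * π)).div_const t
    refine ((h.arctan.const_mul (1 / π)).sub ((hasDerivAt_id u).const_mul
      (2 * t / (t ^ 2 + (2 * π * (k + 1)) ^ 2)))).congr_deriv ?_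
    have hp : t ^ 2 + (2 * π * (k + u)) ^ 2 ≠ 0 := by positivity
    have hp' : 1 + (2 * π * (k + u) / t) ^ 2 = (t ^ 2 + (2 * π * (k + u)) ^ 2) / t ^ 2 := by
      field_simp
    rw [hp']
    field_simp
  · refine Continuous.intervalIntegrable ?_ _ _
    refine Continuous.sub (Continuous.div (by fun_prop) (by fun_prop) fun u => ?_)
      continuous_const
    positivity

lemma cauchy_kernel_antitoneOn {t : ℝ} (ht : 0 < t) :
    AntitoneOn (fun u : ℝ => 2 * t / (t ^ 2 + (2 * π * u) ^ 2)) (Ici 0) := by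
  intro u hu v _ huv
  have hu' : 0 ≤ u := hu
  refine div_le_div_of_nonneg_left (by positivity) (by positivity) ?_
  gcongr

lemma hasSum_cauchy_kernel {t : ℝ} (ht : 0 < t) :
    HasSum (fun k : ℕ => ∫ u in (0 : ℝ)..1, (2 * t / (t ^ 2 + (2 * π * (k + u)) ^ 2) -
        2 * t / (t ^ 2 + (2 * π * (k + 1)) ^ 2))) (digammaKernel t) := by
  rw [hasSum_iff_tendsto_nat_of_nonneg]
  · simp_rw [integral_cauchy_kernel ht, Finset.sum_sub_distrib]
    have htel : ∀ N : ℕ, ∑ k ∈ Finset.range N, 1 / π * Real.arctan (2 * π * (k + 1) / t) -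
        ∑ k ∈ Finset.range N, 1 / π * Real.arctan (2 * π * k / t) =
        1 / π * Real.arctan (2 * π * N / t) := by
      intro N
      rw [← Finset.sum_sub_distrib]
      have := Finset.sum_range_sub (fun k : ℕ => 1 / π * Real.arctan (2 * π * k / t)) N
      simpa using this
    simp_rw [htel]
    have hlin : Tendsto (fun N : ℕ => 2 * π * N / t) atTop atTop :=
      (tendsto_natCast_atTop_atTop.const_mul_atTop (by positivity)).atTop_div_const ht
    have h1 : Tendsto (fun N : ℕ => 1 / π * Real.arctan (2 * π * N / t)) atTop
        (𝓝 (1 / π * (π / 2))) :=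
      ((Real.tendsto_arctan_atTop.mono_right nhdsWithin_le_nhds).comp hlin).const_mul _
    have h2 := h1.sub (hasSum_inv_exp_sub_one ht).tendsto_sum_nat
    convert h2 using 2
    field_simp
    ring
  · intro k
    have hk : (0 : ℝ) ≤ k := k.cast_nonneg
    refine intervalIntegral.integral_nonneg zero_le_one fun u hu => sub_nonneg.2 ?_
    exact cauchy_kernel_antitoneOn ht (mem_Ici.2 (by linarith [hu.1]))
      (mem_Ici.2 (by linarith)) (by linarith [hu.2])

lemma tendsto_arctan_div_atTop {a : ℝ} (ha : 0 < a) :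
    Tendsto (fun t : ℝ => Real.arctan (t / a)) atTop (𝓝 (π / 2)) :=
  (Real.tendsto_arctan_atTop.mono_right nhdsWithin_le_nhds).comp
    (tendsto_id.atTop_div_const ha)

lemma hasDerivAt_arctan_div {a : ℝ} (ha : 0 < a) (t : ℝ) :
    HasDerivAt (fun t : ℝ => Real.arctan (t / a)) (a / (t ^ 2 + a ^ 2)) t := by
  refine ((hasDerivAt_id t).div_const a).arctan.congr_deriv ?_
  have hp' : 1 + (t / a) ^ 2 = (t ^ 2 + a ^ 2) / a ^ 2 := by
    field_simp
    ring
  simp only [id]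
  rw [hp']
  field_simp

lemma tendsto_div_sq_add_sq {a : ℝ} (ha : 0 < a) :
    Tendsto (fun t : ℝ => t / (t ^ 2 + a ^ 2)) atTop (𝓝 0) := by
  refine tendsto_of_tendsto_of_tendsto_of_le_of_le' tendsto_const_nhds tendsto_inv_atTop_zero
    ?_ ?_
  · filter_upwards [eventually_gt_atTop 0] with t ht
    positivity
  · filter_upwards [eventually_gt_atTop 0] with t ht
    rw [div_le_iff₀ (by positivity)]
    have : t⁻¹ * (t ^ 2 + a ^ 2) = t + t⁻¹ * a ^ 2 := by field_simp
    rw [this]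
    have : 0 ≤ t⁻¹ * a ^ 2 := by positivity
    linarith

lemma integral_cauchy_mul_cauchy {a b : ℝ} (ha : 0 < a) (hb : 0 < b) :
    IntegrableOn (fun t => 2 * t / (t ^ 2 + b ^ 2) * (t / (t ^ 2 + a ^ 2))) (Ioi 0) ∧
      ∫ t in Ioi 0, 2 * t / (t ^ 2 + b ^ 2) * (t / (t ^ 2 + a ^ 2)) = π / (a + b) := by
  suffices H : ∃ g : ℝ → ℝ, g 0 = 0 ∧ Tendsto g atTop (𝓝 (π / (a + b))) ∧ ∀ t : ℝ,
      HasDerivAt g (2 * t / (t ^ 2 + b ^ 2) * (t / (t ^ 2 + a ^ 2))) t by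
    obtain ⟨g, g0, gl, gd⟩ := H
    have hpos : ∀ t ∈ Ioi (0 : ℝ), 0 ≤ 2 * t / (t ^ 2 + b ^ 2) * (t / (t ^ 2 + a ^ 2)) := by
      intro t ht
      have : 0 < t := ht
      positivity
    refine ⟨integrableOn_Ioi_deriv_of_nonneg' (fun t _ => gd t) hpos gl, ?_⟩
    rw [integral_Ioi_of_hasDerivAt_of_nonneg' (fun t _ => gd t) hpos gl, g0, sub_zero]
  rcases eq_or_ne a b with rfl | hab
  · refine ⟨fun t => 1 / a * Real.arctan (t / a) - t / (t ^ 2 + a ^ 2), by simp, ?_, ?_⟩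
    · convert ((tendsto_arctan_div_atTop ha).const_mul (1 / a)).sub
        (tendsto_div_sq_add_sq ha) using 2
      field_simp
      ring
    · intro t
      have hp : t ^ 2 + a ^ 2 ≠ 0 := by positivity
      refine (((hasDerivAt_arctan_div ha t).const_mul (1 / a)).sub
        ((hasDerivAt_id t).div ((hasDerivAt_pow 2 t).add_const (a ^ 2)) hp)).congr_deriv ?_
      simp only [id]
      field_simp
      ring
  · have hsub : a - b ≠ 0 := sub_ne_zero.2 hab
    refine ⟨fun t => 2 / (a ^ 2 - b ^ 2) *
      (a * Real.arctan (t / a) - b * Real.arctan (t / b)), by simp, ?_, ?_⟩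
    · convert (((tendsto_arctan_div_atTop ha).const_mul a).sub
        ((tendsto_arctan_div_atTop hb).const_mul b)).const_mul (2 / (a ^ 2 - b ^ 2)) using 2
      have : a + b ≠ 0 := by positivity
      rw [sq_sub_sq]
      field_simp
    · intro t
      have hp : t ^ 2 + a ^ 2 ≠ 0 := by positivity
      have hq : t ^ 2 + b ^ 2 ≠ 0 := by positivity
      refine ((((hasDerivAt_arctan_div ha t).const_mul a).sub
        ((hasDerivAt_arctan_div hb t).const_mul b)).const_mul
          (2 / (a ^ 2 - b ^ 2))).congr_deriv ?_
      have : a + b ≠ 0 := by positivity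
      rw [sq_sub_sq]
      field_simp
      ring

lemma digamma_sub_log_eq_cauchy {n : ℝ} (hn : 0 < n) :
    IntegrableOn (fun t => digammaKernel t * (t / (t ^ 2 + (2 * π * n) ^ 2))) (Ioi 0) ∧
      ∫ t in Ioi 0, digammaKernel t * (t / (t ^ 2 + (2 * π * n) ^ 2)) =
        1 / 2 * (digamma (1 + n) - Real.log n) := by
  refine integral_telescoping_kernel (K := fun t u => 2 * t / (t ^ 2 + (2 * π * u) ^ 2))
    hn (by norm_num) (by unfold Function.uncurry; fun_prop) (by fun_prop)
    measurable_digammaKernel (fun t ht => by positivity)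
    (fun t ht => cauchy_kernel_antitoneOn ht)
    (fun t ht => Continuous.div (by fun_prop) (by fun_prop) fun u => by positivity)
    (fun t ht => hasSum_cauchy_kernel ht) fun v hv => ?_
  obtain ⟨h1, h2⟩ := integral_cauchy_mul_cauchy (by positivity : 0 < 2 * π * n)
    (by positivity : 0 < 2 * π * v)
  refine ⟨h1, h2.trans ?_⟩
  field_simp

lemma integral_exp_mul_cos {a : ℝ} (ha : 0 < a) (t T : ℝ) :
    ∫ x in (0 : ℝ)..T, Real.exp (-(x * t)) * Real.cos (a * x) =
      t / (t ^ 2 + a ^ 2) + Real.exp (-(T * t)) *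
        ((a * Real.sin (a * T) - t * Real.cos (a * T)) / (t ^ 2 + a ^ 2)) := by
  rw [integral_eq_sub_of_hasDerivAt (f := fun x : ℝ => Real.exp (-(x * t)) *
        ((a * Real.sin (a * x) - t * Real.cos (a * x)) / (t ^ 2 + a ^ 2)))]
  · simp
    ring
  · intro x _
    have hp : t ^ 2 + a ^ 2 ≠ 0 := by positivity
    have h1 : HasDerivAt (fun x : ℝ => -(x * t)) (-(1 * t)) x :=
      ((hasDerivAt_id x).mul_const t).neg
    have h2 : HasDerivAt (fun x : ℝ => a * x) (a * 1) x := (hasDerivAt_id x).const_mul a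
    refine (h1.exp.mul (((h2.sin.const_mul a).sub (h2.cos.const_mul t)).div_const
      (t ^ 2 + a ^ 2))).congr_deriv ?_
    simp only [Pi.sub_apply]
    field_simp
    ring
  · exact Continuous.intervalIntegrable (by fun_prop) _ _

lemma abs_oscillating_le {a t : ℝ} (ha : 0 < a) (ht : 0 < t) (θ : ℝ) :
    |(a * Real.sin θ - t * Real.cos θ) / (t ^ 2 + a ^ 2)| ≤ 2 / a := by
  have hp : 0 < t ^ 2 + a ^ 2 := by positivity
  rw [abs_div, abs_of_pos hp, div_le_div_iff₀ hp ha]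
  have h1 : |a * Real.sin θ - t * Real.cos θ| ≤ a + t := by
    refine (abs_sub _ _).trans ?_
    rw [abs_mul, abs_mul, abs_of_pos ha, abs_of_pos ht]
    nlinarith [Real.abs_sin_le_one θ, Real.abs_cos_le_one θ]
  nlinarith [sq_nonneg (a - t)]

lemma integral_exp_neg_mul_le {a t T : ℝ} (ht : 0 < t) (hT : 0 ≤ T) :
    ∫ x in (0 : ℝ)..T, Real.exp (-(x * t)) ≤
      T * Real.exp 1 * Real.exp (-(1 * t)) + (1 + a ^ 2) * (t / (t ^ 2 + a ^ 2)) := by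
  have hp : 0 < t ^ 2 + a ^ 2 := by positivity
  rcases le_total t 1 with h | h
  · have h1 : ∫ x in (0 : ℝ)..T, Real.exp (-(x * t)) ≤ ∫ _ in (0 : ℝ)..T, (1 : ℝ) := by
      refine intervalIntegral.integral_mono_on hT
        (Continuous.intervalIntegrable (by fun_prop) _ _) (by simp) fun x hx => ?_
      exact Real.exp_le_one_iff.2 (neg_nonpos.2 (mul_nonneg hx.1 ht.le))
    have h2 : 1 ≤ Real.exp 1 * Real.exp (-(1 * t)) := by
      rw [← Real.exp_add]
      exact Real.one_le_exp (by linarith)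
    have h3 : 0 ≤ (1 + a ^ 2) * (t / (t ^ 2 + a ^ 2)) := by positivity
    simp only [intervalIntegral.integral_const, sub_zero, smul_eq_mul, mul_one] at h1
    nlinarith
  · have h1 : ∫ x in (0 : ℝ)..T, Real.exp (-(x * t)) = (1 - Real.exp (-(T * t))) / t := by
      rw [integral_eq_sub_of_hasDerivAt (f := fun x : ℝ => -Real.exp (-(x * t)) / t)]
      · simp
        ring
      · intro x _
        have h1 : HasDerivAt (fun x : ℝ => -(x * t)) (-(1 * t)) x :=
          ((hasDerivAt_id x).mul_const t).neg
        refine (h1.exp.neg.div_const t).congr_deriv ?_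
        field_simp
      · exact Continuous.intervalIntegrable (by fun_prop) _ _
    have h2 : (1 - Real.exp (-(T * t))) / t ≤ 1 / t := by
      gcongr
      linarith [Real.exp_pos (-(T * t))]
    have h3 : 1 / t ≤ (1 + a ^ 2) * (t / (t ^ 2 + a ^ 2)) := by
      rw [← mul_div_assoc, div_le_div_iff₀ ht hp]
      nlinarith [mul_nonneg (sq_nonneg a) (by nlinarith : 0 ≤ t ^ 2 - 1)]
    have h4 : 0 ≤ T * Real.exp 1 * Real.exp (-(1 * t)) := by positivity
    linarith

lemma integrable_digammaKernel_mul_exp_mul_cos {n T : ℝ} (hn : 0 < n) (hT : 0 ≤ T) :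
    Integrable (Function.uncurry fun t x : ℝ =>
        digammaKernel t * (Real.exp (-(x * t)) * Real.cos (2 * π * n * x)))
      ((volume.restrict (Ioi 0)).prod (volume.restrict (Ioc 0 T))) := by
  have hφ := measurable_digammaKernel
  have hG : Integrable (fun p : ℝ × ℝ => digammaKernel p.1 * Real.exp (-(p.2 * p.1)))
      ((volume.restrict (Ioi 0)).prod (volume.restrict (Ioc 0 T))) := by
    have hm : AEStronglyMeasurable
        (fun p : ℝ × ℝ => digammaKernel p.1 * Real.exp (-(p.2 * p.1)))
        ((volume.restrict (Ioi 0)).prod (volume.restrict (Ioc 0 T))) := by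
      exact Measurable.aestronglyMeasurable (by fun_prop)
    rw [integrable_prod_iff hm]
    refine ⟨Eventually.of_forall fun t => ?_, ?_⟩
    · have hc : Continuous fun x : ℝ => digammaKernel t * Real.exp (-(x * t)) :=
        continuous_const.mul (by fun_prop)
      exact hc.integrableOn_Icc.mono_set Ioc_subset_Icc_self
    · refine Integrable.mono'
        (((digamma_sub_log_eq_laplace one_pos).1.const_mul (T * Real.exp 1)).add
          ((digamma_sub_log_eq_cauchy hn).1.const_mul (1 + (2 * π * n) ^ 2)))
        hm.norm.integral_prod_right' ?_
      filter_upwards [ae_restrict_mem measurableSet_Ioi] with t ht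
      have h0 := digammaKernel_nonneg ht
      rw [Real.norm_of_nonneg (integral_nonneg fun x => norm_nonneg _)]
      simp only [norm_mul, Real.norm_of_nonneg h0, Real.norm_of_nonneg (Real.exp_pos _).le]
      rw [MeasureTheory.integral_const_mul, ← intervalIntegral.integral_of_le hT]
      refine (mul_le_mul_of_nonneg_left
        (integral_exp_neg_mul_le (a := 2 * π * n) ht hT) h0).trans (le_of_eq ?_)
      simp only [Pi.add_apply]
      ring
  refine hG.mono (Measurable.aestronglyMeasurable (by unfold Function.uncurry; fun_prop))
    (Eventually.of_forall fun p => ?_)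
  simp only [Function.uncurry, norm_mul]
  rw [← mul_assoc]
  exact mul_le_of_le_one_right (by positivity) (Real.abs_cos_le_one _)

lemma integral_digamma_sub_log_mul_cos {n T : ℝ} (hn : 0 < n) (hT : 0 ≤ T) :
    ∫ x in (0 : ℝ)..T, (digamma (1 + x) - Real.log x) * Real.cos (2 * π * n * x) =
      ∫ t in Ioi 0, digammaKernel t * (t / (t ^ 2 + (2 * π * n) ^ 2) + Real.exp (-(T * t)) *
        ((2 * π * n * Real.sin (2 * π * n * T) - t * Real.cos (2 * π * n * T)) /
          (t ^ 2 + (2 * π * n) ^ 2))) := by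
  have ha : 0 < 2 * π * n := by positivity
  simp_rw [← integral_exp_mul_cos ha, intervalIntegral.integral_of_le hT,
    ← MeasureTheory.integral_const_mul]
  rw [integral_integral_swap (integrable_digammaKernel_mul_exp_mul_cos hn hT)]
  refine setIntegral_congr_fun measurableSet_Ioc fun x hx => ?_
  simp only [← mul_assoc]
  rw [MeasureTheory.integral_mul_const, (digamma_sub_log_eq_laplace hx.1).2]

end

theorem digamma_self_reciprocal (n : ℝ) (hn : 0 < n) :
    Tendsto (fun T : ℝ =>
        ∫ x in (0 : ℝ)..T, (digamma (1 + x) - Real.log x) * Real.cos (2 * π * n * x))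
      atTop (nhds ((1 / 2) * (digamma (1 + n) - Real.log n))) := by
  have ha : 0 < 2 * π * n := by positivity
  have hφ := measurable_digammaKernel
  obtain ⟨hcI, hc⟩ := digamma_sub_log_eq_cauchy hn
  have hlI := (digamma_sub_log_eq_laplace one_pos).1
  rw [← hc]
  refine Tendsto.congr' (f₁ := fun T : ℝ => ∫ t in Set.Ioi 0, digammaKernel t *
    (t / (t ^ 2 + (2 * π * n) ^ 2) + Real.exp (-(T * t)) *
        ((2 * π * n * Real.sin (2 * π * n * T) - t * Real.cos (2 * π * n * T)) /
          (t ^ 2 + (2 * π * n) ^ 2)))) ?_ ?_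
  · filter_upwards [eventually_ge_atTop 0] with T hT
    exact (integral_digamma_sub_log_mul_cos hn hT).symm
  refine MeasureTheory.tendsto_integral_filter_of_dominated_convergence _
    (Eventually.of_forall fun T => Measurable.aestronglyMeasurable (by fun_prop)) ?_
    (hcI.add (hlI.const_mul (2 / (2 * π * n)))) ?_
  · filter_upwards [eventually_ge_atTop 1] with T hT
    filter_upwards [ae_restrict_mem measurableSet_Ioi] with t ht
    have ht : 0 < t := ht
    have h0 := digammaKernel_nonneg ht
    have h1 := abs_oscillating_le ha ht (2 * π * n * T)
    have h2 : Real.exp (-(T * t)) ≤ Real.exp (-(1 * t)) := Real.exp_le_exp.2 (by nlinarith)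
    rw [norm_mul, Real.norm_of_nonneg h0]
    have h3 : ‖t / (t ^ 2 + (2 * π * n) ^ 2) + Real.exp (-(T * t)) *
        ((2 * π * n * Real.sin (2 * π * n * T) - t * Real.cos (2 * π * n * T)) /
          (t ^ 2 + (2 * π * n) ^ 2))‖ ≤
        t / (t ^ 2 + (2 * π * n) ^ 2) + Real.exp (-(1 * t)) * (2 / (2 * π * n)) := by
      refine (norm_add_le _ _).trans (add_le_add ?_ ?_)
      · rw [Real.norm_of_nonneg (by positivity)]
      · rw [norm_mul, Real.norm_of_nonneg (Real.exp_pos _).le]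
        exact mul_le_mul h2 h1 (abs_nonneg _) (Real.exp_pos _).le
    refine (mul_le_mul_of_nonneg_left h3 h0).trans (le_of_eq ?_)
    simp only [Pi.add_apply]
    ring
  · filter_upwards [ae_restrict_mem measurableSet_Ioi] with t ht
    have ht : 0 < t := ht
    have hexp : Tendsto (fun T : ℝ => Real.exp (-(T * t)) * (2 / (2 * π * n))) atTop
        (nhds 0) := by
      have := (Real.tendsto_exp_neg_atTop_nhds_zero.comp
        (tendsto_id.atTop_mul_const ht)).mul_const (2 / (2 * π * n))
      simpa using this
    have hosc : Tendsto (fun T : ℝ => Real.exp (-(T * t)) *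
        ((2 * π * n * Real.sin (2 * π * n * T) - t * Real.cos (2 * π * n * T)) /
          (t ^ 2 + (2 * π * n) ^ 2))) atTop (nhds 0) := by
      refine squeeze_zero_norm (fun T => ?_) hexp
      rw [norm_mul, Real.norm_of_nonneg (Real.exp_pos _).le]
      exact mul_le_mul_of_nonneg_left (abs_oscillating_le ha ht _) (Real.exp_pos _).le
    simpa using (tendsto_const_nhds.add hosc).const_mul (digammaKernel t)
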